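/- arXiv:1411.6065 — 4 statements merged into one kernel-verified Lean document; each statement's English description precedes it below -/
import Mathlib

section
/- Let C > 0 and 0 < f < 1 be real numbers, and let (e_k)_{k≥0} and (a_k)_{k≥0} be sequences of positive real numbers satisfying, for every k ≥ 1, e_k ≤ C·(e_{k-1} + a_k)² and a_k ≤ a_{k-1} ≤ f⁻¹·a_k. If a_0 ≤ f/(4C) and e_0 ≤ 4C·a_0², then e_k ≤ 4C·a_k² for all k ≥ 0. -/
/-- Lemma 5.3 of the paper (abstract multigrid error recursion).
If `e_k ≤ C (e_{k-1} + a_k)²` and `a_k ≤ a_{k-1} ≤ f⁻¹ a_k` for every `k ≥ 1`,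
with `a_0 ≤ f/(4C)` and `e_0 ≤ 4 C a_0²`, then `e_k ≤ 4 C a_k²` for all `k`. -/
theorem stmt0 (C f : ℝ) (hC : 0 < C) (hf0 : 0 < f) (hf1 : f < 1)
    (e a : ℕ → ℝ) (he : ∀ k, 0 < e k) (ha : ∀ k, 0 < a k)
    (hrec : ∀ k : ℕ, 1 ≤ k → e k ≤ C * (e (k - 1) + a k) ^ 2)
    (hmono : ∀ k : ℕ, 1 ≤ k → a k ≤ a (k - 1))
    (hratio : ∀ k : ℕ, 1 ≤ k → a (k - 1) ≤ f⁻¹ * a k)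
    (ha0 : a 0 ≤ f / (4 * C)) (he0 : e 0 ≤ 4 * C * (a 0) ^ 2) :
    ∀ k : ℕ, e k ≤ 4 * C * (a k) ^ 2 := by
  have hle : ∀ k, a k ≤ a 0 := fun k =>
    antitone_nat_of_succ_le (fun n => hmono (n + 1) n.succ_pos) (Nat.zero_le k)
  intro k
  induction k with
  | zero => exact he0
  | succ n ih =>
    have hsmall : 4 * C * a n ≤ f := by
      have h := (le_div_iff₀ (by positivity)).1 ((hle n).trans ha0)
      linarith
    have hr : f * a n ≤ a (n + 1) := (le_inv_mul_iff₀ hf0).1 (hratio (n + 1) n.succ_pos)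
    have hen : e n ≤ a (n + 1) := by
      calc e n ≤ 4 * C * a n ^ 2 := ih
        _ = 4 * C * a n * a n := by ring
        _ ≤ f * a n := mul_le_mul_of_nonneg_right hsmall (ha n).le
        _ ≤ a (n + 1) := hr
    have hpos := he n
    calc e (n + 1) ≤ C * (e n + a (n + 1)) ^ 2 := hrec (n + 1) n.succ_pos
      _ ≤ C * (a (n + 1) + a (n + 1)) ^ 2 := by
        have := ha (n + 1)
        gcongr
      _ = 4 * C * a (n + 1) ^ 2 := by ring
end

section
/- Let X be a finite-dimensional real inner product space and let A and H be symmetric positive definite linear operators on X such that d_X(A, H⁻¹) < 0.4, where d_X denotes the spectral distance. Then the operator 2A − A∘H∘A is symmetric positive definite and d_X(2A − A∘H∘A, H⁻¹) ≤ 2·(d_X(A, H⁻¹))². -/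
open RealInnerProductSpace

/-- The spectral distance between two operators on a real inner product space:
`d_X(A,B) = sup_{u ≠ 0} |ln (⟨Au,u⟩ / ⟨Bu,u⟩)|`. -/
noncomputable def specDist {X : Type*} [NormedAddCommGroup X] [InnerProductSpace ℝ X]
    (A B : X →ₗ[ℝ] X) : ℝ :=
  ⨆ u : {v : X // v ≠ 0}, |Real.log (⟪A u.1, u.1⟫ / ⟪B u.1, u.1⟫)|

theorem specDist_bddAbove {X : Type*} [NormedAddCommGroup X] [InnerProductSpace ℝ X]
    [FiniteDimensional ℝ X] {A B : X →ₗ[ℝ] X}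
    (hA : ∀ u : X, u ≠ 0 → 0 < ⟪A u, u⟫) (hB : ∀ u : X, u ≠ 0 → 0 < ⟪B u, u⟫) :
    BddAbove (Set.range fun u : {v : X // v ≠ 0} =>
      |Real.log (⟪A u.1, u.1⟫ / ⟪B u.1, u.1⟫)|) := by
  have : ProperSpace X := FiniteDimensional.proper_real X
  have hAc : Continuous A := A.continuous_of_finiteDimensional
  have hBc : Continuous B := B.continuous_of_finiteDimensional
  have hne : ∀ u ∈ Metric.sphere (0 : X) 1, u ≠ 0 := fun u hu =>
    ne_zero_of_mem_unit_sphere ⟨u, hu⟩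
  have hcont : ContinuousOn (fun u : X => |Real.log (⟪A u, u⟫ / ⟪B u, u⟫)|)
      (Metric.sphere (0 : X) 1) := by
    refine (ContinuousOn.log (ContinuousOn.div ?_ ?_ ?_) ?_).abs
    · exact (hAc.inner continuous_id).continuousOn
    · exact (hBc.inner continuous_id).continuousOn
    · exact fun u hu => (hB u (hne u hu)).ne'
    · exact fun u hu => (div_pos (hA u (hne u hu)) (hB u (hne u hu))).ne'
  refine ((isCompact_sphere (0 : X) 1).bddAbove_image hcont).mono ?_
  rintro _ ⟨⟨u, hu⟩, rfl⟩
  have hn : ‖u‖ ≠ 0 := norm_ne_zero_iff.mpr hu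
  refine ⟨‖u‖⁻¹ • u, ?_, ?_⟩
  · simp [norm_smul, hn]
  · simp only [map_smul, real_inner_smul_left, real_inner_smul_right]
    rw [mul_div_mul_left _ _ (inv_ne_zero hn), mul_div_mul_left _ _ (inv_ne_zero hn)]

theorem specDist_nonneg {X : Type*} [NormedAddCommGroup X] [InnerProductSpace ℝ X]
    (A B : X →ₗ[ℝ] X) : 0 ≤ specDist A B :=
  Real.iSup_nonneg fun _ => abs_nonneg _

/-- The quadratic forms of two operators at spectral distance `d` differ by at most
`(exp d - 1) ⟪B u, u⟫`. -/
theorem abs_inner_sub_le_of_specDist {X : Type*} [NormedAddCommGroup X] [InnerProductSpace ℝ X]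
    [FiniteDimensional ℝ X] {A B : X →ₗ[ℝ] X}
    (hA : ∀ u : X, u ≠ 0 → 0 < ⟪A u, u⟫) (hB : ∀ u : X, u ≠ 0 → 0 < ⟪B u, u⟫) (u : X) :
    |⟪(B - A) u, u⟫| ≤ (Real.exp (specDist A B) - 1) * ⟪B u, u⟫ := by
  rcases eq_or_ne u 0 with rfl | hu
  · simp
  have ha := hA u hu
  have hb := hB u hu
  have h : |Real.log (⟪A u, u⟫ / ⟪B u, u⟫)| ≤ specDist A B :=
    le_ciSup (specDist_bddAbove hA hB) (⟨u, hu⟩ : {v : X // v ≠ 0})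
  obtain ⟨h1, h2⟩ := abs_le.mp h
  rw [Real.log_le_iff_le_exp (div_pos ha hb), div_le_iff₀ hb] at h2
  rw [Real.le_log_iff_exp_le (div_pos ha hb), le_div_iff₀ hb] at h1
  have h3 : 2 - Real.exp (specDist A B) ≤ Real.exp (-specDist A B) := by
    linarith [Real.one_le_cosh (specDist A B), Real.cosh_eq (specDist A B)]
  rw [LinearMap.sub_apply, inner_sub_left, abs_le]
  constructor <;> nlinarith

/-- A Cauchy–Schwarz estimate: a symmetric form bounded by `ε B` on the diagonal satisfies
`E B⁻¹ E ≤ ε² B`. -/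
theorem inner_inv_le_sq_mul {X : Type*} [NormedAddCommGroup X] [InnerProductSpace ℝ X]
    {E H B : X →ₗ[ℝ] X} {ε : ℝ} (hε : 0 ≤ ε)
    (hE : ∀ u v : X, ⟪E u, v⟫ = ⟪u, E v⟫) (hBH : B ∘ₗ H = LinearMap.id)
    (hbound : ∀ u : X, |⟪E u, u⟫| ≤ ε * ⟪B u, u⟫) (u : X) :
    ⟪E u, H (E u)⟫ ≤ ε ^ 2 * ⟪B u, u⟫ := by
  have hBH' : ∀ x, B (H x) = x := fun x => LinearMap.congr_fun hBH x
  have key : ∀ x v : X, 4 * ⟪E x, v⟫ ≤ ε * (2 * ⟪B x, x⟫ + 2 * ⟪B v, v⟫) := by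
    intro x v
    have h1 := (abs_le.mp (hbound (x + v))).2
    have h2 := (abs_le.mp (hbound (x - v))).1
    have h3 : ⟪E v, x⟫ = ⟪E x, v⟫ := by rw [hE v x, real_inner_comm]
    simp only [map_add, map_sub, inner_add_left, inner_add_right, inner_sub_left,
      inner_sub_right] at h1 h2
    linarith
  rcases hε.eq_or_lt with rfl | hpos
  · have := key u (H (E u))
    linarith
  · have h := key (ε • u) (H (E u))
    simp only [map_smul, real_inner_smul_left, real_inner_smul_right, hBH'] at h
    refine le_of_mul_le_mul_left ?_ hpos
    linarith

theorem exp_neg_two_mul_sq_le {d : ℝ} (h0 : 0 ≤ d) (h1 : d ≤ 0.4) :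
    Real.exp (-(2 * d ^ 2)) ≤ 1 - (Real.exp d - 1) ^ 2 := by
  have he : Real.exp d - 1 ≤ d * 1.24 := by
    have h := Real.exp_bound' h0 (by linarith) (n := 3) (by norm_num)
    norm_num [Finset.sum_range_succ, Nat.factorial] at h h1
    nlinarith [mul_nonneg h0 (sub_nonneg.mpr h1),
      mul_nonneg (mul_nonneg h0 h0) (sub_nonneg.mpr h1)]
  have he0 : 0 ≤ Real.exp d - 1 := by linarith [Real.one_le_exp h0]
  have hsq : (Real.exp d - 1) ^ 2 ≤ 1.5376 * d ^ 2 :=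
    (pow_le_pow_left₀ he0 he 2).trans_eq (by ring)
  have ht : d ^ 2 ≤ 0.16 := by norm_num at h1 ⊢; nlinarith
  have hq := Real.quadratic_le_exp_of_nonneg (by positivity : 0 ≤ 2 * d ^ 2)
  have ht0 : 0 ≤ d ^ 2 := sq_nonneg d
  generalize d ^ 2 = t at *
  refine le_trans ?_ (sub_le_sub_left hsq 1)
  rw [Real.exp_neg, inv_le_iff_one_le_mul₀ (Real.exp_pos _)]
  have h3 : 0 ≤ 1 - 1.5376 * t := by norm_num at ht ⊢; linarith
  refine le_trans ?_ (mul_le_mul_of_nonneg_left hq h3)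
  have h4 : 0 ≤ t * (0.4624 - 1.0752 * t - 3.0752 * t ^ 2) := by
    refine mul_nonneg ht0 ?_
    norm_num at ht ⊢
    nlinarith
  linarith

/-- quadratic convergence of the Newton map `A ↦ 2A - A H A` towards `H⁻¹`
measured in the spectral distance: if `A, H` are symmetric positive definite and
`d_X(A, H⁻¹) < 0.4`, then `2A - A H A` is symmetric positive definite and
`d_X(2A - A H A, H⁻¹) ≤ 2 (d_X(A, H⁻¹))²`. -/
theorem stmt1 {X : Type*} [NormedAddCommGroup X] [InnerProductSpace ℝ X]
    [FiniteDimensional ℝ X]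
    (A H Hinv : X →ₗ[ℝ] X)
    (hAsymm : ∀ u v : X, ⟪A u, v⟫ = ⟪u, A v⟫)
    (hApd : ∀ u : X, u ≠ 0 → 0 < ⟪A u, u⟫)
    (hHsymm : ∀ u v : X, ⟪H u, v⟫ = ⟪u, H v⟫)
    (hHpd : ∀ u : X, u ≠ 0 → 0 < ⟪H u, u⟫)
    (hinv1 : Hinv ∘ₗ H = LinearMap.id) (hinv2 : H ∘ₗ Hinv = LinearMap.id)
    (hclose : specDist A Hinv < 0.4) :
    (∀ u v : X, ⟪((2:ℝ) • A - A ∘ₗ H ∘ₗ A) u, v⟫ = ⟪u, ((2:ℝ) • A - A ∘ₗ H ∘ₗ A) v⟫) ∧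
    (∀ u : X, u ≠ 0 → 0 < ⟪((2:ℝ) • A - A ∘ₗ H ∘ₗ A) u, u⟫) ∧
    specDist ((2:ℝ) • A - A ∘ₗ H ∘ₗ A) Hinv ≤ 2 * (specDist A Hinv) ^ 2 := by
  have hHB : ∀ x, H (Hinv x) = x := fun x => LinearMap.congr_fun hinv2 x
  have hBsymm : ∀ u v : X, ⟪Hinv u, v⟫ = ⟪u, Hinv v⟫ := fun u v => by
    simpa only [hHB] using (hHsymm (Hinv u) (Hinv v)).symm
  have hBpd : ∀ u : X, u ≠ 0 → 0 < ⟪Hinv u, u⟫ := fun u hu => by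
    have h := hHpd (Hinv u) fun h => hu (by rw [← hHB u, h, map_zero])
    rwa [hHB, real_inner_comm] at h
  have hEsymm : ∀ u v : X, ⟪(Hinv - A) u, v⟫ = ⟪u, (Hinv - A) v⟫ := fun u v => by
    simp only [LinearMap.sub_apply, inner_sub_left, inner_sub_right, hAsymm, hBsymm]
  set d := specDist A Hinv
  have hd0 : 0 ≤ d := specDist_nonneg A Hinv
  have hscalar := exp_neg_two_mul_sq_le hd0 hclose.le
  have hform : ∀ u : X, ⟪((2:ℝ) • A - A ∘ₗ H ∘ₗ A) u, u⟫
      = ⟪Hinv u, u⟫ - ⟪(Hinv - A) u, H ((Hinv - A) u)⟫ := fun u => by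
    have h1 : ⟪Hinv u, H (A u)⟫ = ⟪A u, u⟫ := by rw [← hHsymm, hHB, real_inner_comm]
    simp only [LinearMap.sub_apply, LinearMap.smul_apply, LinearMap.comp_apply, map_sub,
      inner_sub_left, inner_sub_right, real_inner_smul_left, hHB, h1, hAsymm (H (A u))]
    rw [real_inner_comm (H (A u)) (A u)]
    ring
  have hlower : ∀ u : X, Real.exp (-(2 * d ^ 2)) * ⟪Hinv u, u⟫
      ≤ ⟪((2:ℝ) • A - A ∘ₗ H ∘ₗ A) u, u⟫ := fun u => by
    have hb : 0 ≤ ⟪Hinv u, u⟫ := by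
      rcases eq_or_ne u 0 with rfl | hu
      · simp
      · exact (hBpd u hu).le
    have h := inner_inv_le_sq_mul (sub_nonneg.mpr (Real.one_le_exp hd0)) hEsymm hinv1
      (abs_inner_sub_le_of_specDist hApd hBpd) u
    rw [hform]
    linarith [mul_le_mul_of_nonneg_right hscalar hb]
  have hupper : ∀ u : X, ⟪((2:ℝ) • A - A ∘ₗ H ∘ₗ A) u, u⟫ ≤ ⟪Hinv u, u⟫ := fun u => by
    rw [hform, ← hHsymm]
    rcases eq_or_ne ((Hinv - A) u) 0 with h | h
    · simp [h]
    · linarith [hHpd _ h]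
  have hpos : ∀ u : X, u ≠ 0 → 0 < ⟪((2:ℝ) • A - A ∘ₗ H ∘ₗ A) u, u⟫ := fun u hu =>
    (mul_pos (Real.exp_pos _) (hBpd u hu)).trans_le (hlower u)
  refine ⟨fun u v => ?_, hpos, Real.iSup_le (fun ⟨u, hu⟩ => ?_) (by positivity)⟩
  · simp only [LinearMap.sub_apply, LinearMap.smul_apply, LinearMap.comp_apply, inner_sub_left,
      inner_sub_right, real_inner_smul_left, real_inner_smul_right, hAsymm, hHsymm]
  · have hb := hBpd u hu
    have hratio := div_pos (hpos u hu) hb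
    rw [abs_of_nonpos (Real.log_nonpos hratio.le ((div_le_one hb).mpr (hupper u))), neg_le,
      Real.le_log_iff_exp_le hratio, le_div_iff₀ hb]
    exact hlower u
end

section
/- Let X be a finite-dimensional real inner product space, β > 0 and ε ≥ 0 with ε/β < 1/2. Let H and S be symmetric linear operators on X such that ⟨Hu, u⟩ ≥ β·‖u‖² for all u ∈ X and the operator norm satisfies ‖H − S‖ ≤ ε. Then S is positive definite and the spectral distance satisfies d_X(S, H) ≤ (3/2)·ε/β. -/
open RealInnerProductSpace

/-- The spectral distance between two continuous linear operators on a real inner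
product space: `d_X(A,B) = sup_{u ≠ 0} |ln (⟨Au,u⟩ / ⟨Bu,u⟩)|`. -/
noncomputable def specDistL {X : Type*} [NormedAddCommGroup X] [InnerProductSpace ℝ X]
    (A B : X →L[ℝ] X) : ℝ :=
  ⨆ u : {v : X // v ≠ 0}, |Real.log (⟪A u.1, u.1⟫ / ⟪B u.1, u.1⟫)|

/-- The chord bound for the logarithm on `[1/2, 1]`. -/
theorem neg_three_halves_mul_le_log_one_sub {t : ℝ} (h0 : 0 ≤ t) (h1 : t ≤ 1 / 2) :
    -(3 / 2 * t) ≤ Real.log (1 - t) := by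
  have h := strictConcaveOn_log_Ioi.concaveOn.2
    (Set.mem_Ioi.2 one_pos) (Set.mem_Ioi.2 one_half_pos)
    (show 0 ≤ 1 - 2 * t by linarith) (show 0 ≤ 2 * t by linarith) (by ring)
  have e : (1 - 2 * t) • (1 : ℝ) + (2 * t) • (1 / 2 : ℝ) = 1 - t := by
    simp only [smul_eq_mul]; ring
  rw [e] at h
  simp only [smul_eq_mul, Real.log_one, one_div, Real.log_inv] at h
  nlinarith [Real.log_two_lt_d9]

theorem abs_log_le_of_abs_sub_one_le {r t : ℝ} (ht : t < 1 / 2) (hr : |r - 1| ≤ t) :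
    |Real.log r| ≤ 3 / 2 * t := by
  have h0 : 0 ≤ t := (abs_nonneg _).trans hr
  obtain ⟨hl, hu⟩ := abs_le.mp hr
  rw [abs_le]
  constructor
  · exact (neg_three_halves_mul_le_log_one_sub h0 ht.le).trans
      (Real.log_le_log (by linarith) (by linarith))
  · linarith [Real.log_le_sub_one_of_pos (show 0 < r by linarith)]

/-- if `H, S` are symmetric, `⟨Hu,u⟩ ≥ β‖u‖²`, and `‖H - S‖ ≤ ε` with
`ε/β < 1/2`, then `S` is positive definite and `d_X(S, H) ≤ (3/2) ε/β`. -/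
theorem stmt4 {X : Type*} [NormedAddCommGroup X] [InnerProductSpace ℝ X]
    [FiniteDimensional ℝ X]
    (β ε : ℝ) (hβ : 0 < β) (hε : 0 ≤ ε) (hratio : ε / β < 1 / 2)
    (H S : X →L[ℝ] X)
    (hHsymm : ∀ u v : X, ⟪H u, v⟫ = ⟪u, H v⟫)
    (hSsymm : ∀ u v : X, ⟪S u, v⟫ = ⟪u, S v⟫)
    (hcoer : ∀ u : X, β * ‖u‖ ^ 2 ≤ ⟪H u, u⟫)
    (hnorm : ‖H - S‖ ≤ ε) :
    (∀ u : X, u ≠ 0 → 0 < ⟪S u, u⟫) ∧ specDistL S H ≤ (3 / 2) * (ε / β) := by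
  have hpos : ∀ u : X, u ≠ 0 → 0 < ⟪H u, u⟫ := fun u hu =>
    (by positivity : 0 < β * ‖u‖ ^ 2).trans_le (hcoer u)
  have hrel : ∀ u : X, u ≠ 0 → |⟪S u, u⟫ / ⟪H u, u⟫ - 1| ≤ ε / β := by
    intro u hu
    have hHu := hpos u hu
    have hdiff : |⟪S u, u⟫ - ⟪H u, u⟫| ≤ ε * ‖u‖ ^ 2 := by
      rw [abs_sub_comm, ← inner_sub_left, ← sub_apply]
      calc |⟪(H - S) u, u⟫| ≤ ‖(H - S) u‖ * ‖u‖ := abs_real_inner_le_norm _ _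
        _ ≤ ε * ‖u‖ * ‖u‖ := by
          gcongr
          exact (H - S).le_of_opNorm_le hnorm u
        _ = ε * ‖u‖ ^ 2 := by ring
    rw [div_sub_one hHu.ne', abs_div, abs_of_pos hHu, div_le_iff₀ hHu]
    calc |⟪S u, u⟫ - ⟪H u, u⟫| ≤ ε * ‖u‖ ^ 2 := hdiff
      _ = ε / β * (β * ‖u‖ ^ 2) := by field_simp
      _ ≤ ε / β * ⟪H u, u⟫ := by
        gcongr
        exact hcoer u
  refine ⟨fun u hu => ?_, ?_⟩
  · have h := (abs_le.mp (hrel u hu)).1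
    have hq : 0 < ⟪S u, u⟫ / ⟪H u, u⟫ := by linarith
    exact (div_pos_iff_of_pos_right (hpos u hu)).mp hq
  · exact Real.iSup_le (fun u => abs_log_le_of_abs_sub_one_le hratio (hrel u.1 u.2))
      (by positivity)
end

section
/- Let a > 0 and define g : ℝ → ℝ by g(t) = sin(a·t)/t for t ≠ 0 and g(0) = a. Then for every s ∈ ℝ, |∫_ℝ e^{-(s−t)²/2} · g(t) dt| ≤ √(2π)·a, and for every s ≠ 0, |∫_ℝ e^{-(s−t)²/2} · g(t) dt| ≤ (2√(2π) + 8a)/|s|. -/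
open MeasureTheory in
/-- A Gaussian centred at `s` is integrable, with the same integral as the centred one. -/
theorem integrable_and_integral_gaussian_shift (b : ℝ) (hb : 0 < b) (s : ℝ) :
    Integrable (fun t : ℝ => Real.exp (-b * (s - t) ^ 2)) ∧
      ∫ t : ℝ, Real.exp (-b * (s - t) ^ 2) = Real.sqrt (Real.pi / b) :=
  ⟨(integrable_exp_neg_mul_sq hb).comp_sub_left s, by
    rw [integral_sub_left_eq_self (fun t : ℝ => Real.exp (-b * t ^ 2)) volume s,
      integral_gaussian]⟩

theorem abs_mul_exp_neg_half_sq_le (u : ℝ) :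
    |u| * Real.exp (-(1 / 2) * u ^ 2) ≤ Real.exp (-(1 / 4) * u ^ 2) := by
  have h : |u| ≤ Real.exp (u ^ 2 / 4) := by
    have h1 := Real.add_one_le_exp (u ^ 2 / 4)
    nlinarith [sq_nonneg (|u| - 2), sq_abs u]
  calc |u| * Real.exp (-(1 / 2) * u ^ 2)
      ≤ Real.exp (u ^ 2 / 4) * Real.exp (-(1 / 2) * u ^ 2) := by gcongr
    _ = Real.exp (-(1 / 4) * u ^ 2) := by rw [← Real.exp_add]; ring_nf

/-- Gaussian convolution bounds for the sinc-type function
`g(t) = sin(at)/t` (with `g(0) = a`):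
`|∫ e^{-(s-t)²/2} g(t) dt| ≤ √(2π) a` for all `s`, and
`|∫ e^{-(s-t)²/2} g(t) dt| ≤ (2√(2π) + 8a)/|s|` for `s ≠ 0`. -/
theorem stmt12 (a : ℝ) (ha : 0 < a) (g : ℝ → ℝ)
    (hg : ∀ t : ℝ, t ≠ 0 → g t = Real.sin (a * t) / t) (hg0 : g 0 = a) :
    (∀ s : ℝ,
      |∫ t : ℝ, Real.exp (-(s - t) ^ 2 / 2) * g t| ≤ Real.sqrt (2 * Real.pi) * a) ∧
    (∀ s : ℝ, s ≠ 0 →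
      |∫ t : ℝ, Real.exp (-(s - t) ^ 2 / 2) * g t| ≤
        (2 * Real.sqrt (2 * Real.pi) + 8 * a) / |s|) := by
  have hga (t : ℝ) : |g t| ≤ a := by
    rcases eq_or_ne t 0 with rfl | ht
    · rw [hg0, abs_of_pos ha]
    · rw [hg t ht, abs_div, div_le_iff₀ (abs_pos.2 ht)]
      exact (Real.abs_sin_le_abs).trans_eq (by rw [abs_mul, abs_of_pos ha])
  have hgt (t : ℝ) : |t| * |g t| ≤ 1 := by
    rcases eq_or_ne t 0 with rfl | ht
    · simp
    · rw [hg t ht, ← abs_mul, mul_div_cancel₀ _ ht]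
      exact Real.abs_sin_le_one _
  have hexp (s t : ℝ) : Real.exp (-(s - t) ^ 2 / 2) = Real.exp (-(1 / 2) * (s - t) ^ 2) := by
    ring_nf
  have hpi : Real.pi / (1 / 2) = 2 * Real.pi := by ring
  simp only [hexp]
  refine ⟨fun s => ?_, fun s hs => ?_⟩
  · obtain ⟨hi, hv⟩ := integrable_and_integral_gaussian_shift (1 / 2) (by norm_num) s
    rw [hpi] at hv
    rw [← hv, ← MeasureTheory.integral_mul_const, ← Real.norm_eq_abs]
    refine MeasureTheory.norm_integral_le_of_norm_le (hi.mul_const a) (.of_forall fun t => ?_)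
    rw [norm_mul, Real.norm_eq_abs, Real.abs_exp, Real.norm_eq_abs]
    gcongr
    exact hga t
  · obtain ⟨hi, hv⟩ := integrable_and_integral_gaussian_shift (1 / 2) (by norm_num) s
    obtain ⟨hi', hv'⟩ := integrable_and_integral_gaussian_shift (1 / 4) (by norm_num) s
    rw [hpi] at hv
    have key : ‖∫ t : ℝ, s * (Real.exp (-(1 / 2) * (s - t) ^ 2) * g t)‖ ≤
        ∫ t : ℝ, (Real.exp (-(1 / 2) * (s - t) ^ 2)
          + a * Real.exp (-(1 / 4) * (s - t) ^ 2)) := by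
      refine MeasureTheory.norm_integral_le_of_norm_le (hi.add (hi'.const_mul a))
        (.of_forall fun t => ?_)
      rw [norm_mul, norm_mul, Real.norm_eq_abs, Real.norm_eq_abs, Real.abs_exp, Real.norm_eq_abs]
      have hs' : |s| * |g t| ≤ 1 + |s - t| * a := calc
        |s| * |g t| ≤ (|t| + |s - t|) * |g t| := by
          gcongr
          simpa using abs_add_le t (s - t)
        _ = |t| * |g t| + |s - t| * |g t| := by ring
        _ ≤ 1 + |s - t| * a := by gcongr; exacts [hgt t, hga t]
      calc |s| * (Real.exp (-(1 / 2) * (s - t) ^ 2) * |g t|)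
          = (|s| * |g t|) * Real.exp (-(1 / 2) * (s - t) ^ 2) := by ring
        _ ≤ (1 + |s - t| * a) * Real.exp (-(1 / 2) * (s - t) ^ 2) := by gcongr
        _ = Real.exp (-(1 / 2) * (s - t) ^ 2)
            + a * (|s - t| * Real.exp (-(1 / 2) * (s - t) ^ 2)) := by ring
        _ ≤ _ := by gcongr; exact abs_mul_exp_neg_half_sq_le _
    rw [MeasureTheory.integral_add hi (hi'.const_mul a), MeasureTheory.integral_const_mul,
      MeasureTheory.integral_const_mul, hv, hv', norm_mul, Real.norm_eq_abs,
      Real.norm_eq_abs] at key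
    have h8 : Real.sqrt (Real.pi / (1 / 4)) ≤ 8 :=
      Real.sqrt_le_iff.2 ⟨by norm_num, by linarith [Real.pi_le_four]⟩
    rw [le_div_iff₀ (abs_pos.2 hs), mul_comm]
    nlinarith [Real.sqrt_nonneg (2 * Real.pi)]
end
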